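/- arXiv:0808.1663 — 10 statements merged into one kernel-verified Lean document; each statement's English description precedes it below -/
import Mathlib

section
/- Let p, q : ℕ → ℕ be functions with disjoint ranges (for all n, m, p n ≠ q m). Define T to be the set of all finite Boolean sequences t such that for every i < length t: if there exists j < length t with p j = i then the i-th entry of t is false, and if there exists j < length t with q j = i then the i-th entry of t is true. Then T is an infinite binary tree, and every infinite path r of T satisfies r (p n) = false and r (q n) = true for all n ∈ ℕ. -/
/-- separating tree for two functions with disjoint ranges. -/
theorem stmt_0 (p q : ℕ → ℕ) (hpq : ∀ n m, p n ≠ q m)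
    (T : Set (List Bool))
    (hT : T = {t : List Bool | ∀ (i : ℕ) (hi : i < t.length),
      ((∃ j < t.length, p j = i) → t.get ⟨i, hi⟩ = false) ∧
      ((∃ j < t.length, q j = i) → t.get ⟨i, hi⟩ = true)}) :
    (∀ t ∈ T, ∀ s, s <+: t → s ∈ T) ∧
    (∀ n : ℕ, ∃ t ∈ T, t.length = n) ∧
    (∀ r : ℕ → Bool, (∀ n : ℕ, (List.ofFn fun i : Fin n => r i) ∈ T) →
      ∀ n : ℕ, r (p n) = false ∧ r (q n) = true) := by
  classical
  subst hT
  refine ⟨?_, ?_, ?_⟩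
  · intro t ht s hs i hi
    have hl := hs.length_le
    obtain ⟨h1, h2⟩ := ht i (lt_of_lt_of_le hi hl)
    have he : s.get ⟨i, hi⟩ = t.get ⟨i, lt_of_lt_of_le hi hl⟩ := by
      simpa using hs.getElem hi
    rw [he]
    exact ⟨fun ⟨j, hj, e⟩ => h1 ⟨j, lt_of_lt_of_le hj hl, e⟩,
      fun ⟨j, hj, e⟩ => h2 ⟨j, lt_of_lt_of_le hj hl, e⟩⟩
  · intro n
    refine ⟨List.ofFn fun i : Fin n => decide (∃ j, q j = (i : ℕ)), ?_, by simp⟩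
    intro i hi
    constructor
    · rintro ⟨j, _, e⟩
      simp only [List.get_eq_getElem, List.getElem_ofFn, decide_eq_false_iff_not]
      rintro ⟨m, hm⟩
      exact hpq j m (e.trans hm.symm)
    · rintro ⟨j, _, e⟩
      simp only [List.get_eq_getElem, List.getElem_ofFn, decide_eq_true_eq]
      exact ⟨j, e⟩
  · intro r hr n
    constructor
    · have h := (hr (n + p n + 1) (p n) (by rw [List.length_ofFn]; omega)).1 ⟨n, by rw [List.length_ofFn]; omega, rfl⟩
      simpa only [List.get_eq_getElem, List.getElem_ofFn] using h
    · have h := (hr (n + q n + 1) (q n) (by rw [List.length_ofFn]; omega)).2 ⟨n, by rw [List.length_ofFn]; omega, rfl⟩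
      simpa only [List.get_eq_getElem, List.getElem_ofFn] using h
end

section
/- Let T be an infinite binary tree and let c : List Bool → ℕ be injective. Suppose r : ℕ → Bool satisfies: for every finite Boolean sequence s, if φ_T(s, false) then r (c s + 2) = false, and if φ_T(s, true) then r (c s + 2) = true. Define ρ : ℕ → Bool by the recursion ρ m = r (c [ρ 0, …, ρ (m−1)] + 2). Then for every m and every n ≥ m, θ_T(n, [ρ 0, …, ρ (m−1)]) holds; in particular every finite initial segment of ρ belongs to T, i.e. ρ is an infinite path of T. -/
/-- `theta T n s` : some element of `T` of length `n` extends `s`. -/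
def theta (T : Set (List Bool)) (n : ℕ) (s : List Bool) : Prop :=
  ∃ t ∈ T, t.length = n ∧ s <+: t

/-- `phi T s b` : for some `n`, `s ++ [b]` extends to level `n` in `T` but `s ++ [!b]` does not. -/
def phi (T : Set (List Bool)) (s : List Bool) (b : Bool) : Prop :=
  ∃ n : ℕ, theta T n (s ++ [b]) ∧ ¬ theta T n (s ++ [!b])

/-- the recursively defined `ρ` is an infinite path of `T`. -/
theorem stmt_2 (T : Set (List Bool))
    (htree : ∀ t ∈ T, ∀ s, s <+: t → s ∈ T)
    (hinf : ∀ n : ℕ, ∃ t ∈ T, t.length = n)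
    (c : List Bool → ℕ) (hc : Function.Injective c)
    (r : ℕ → Bool)
    (hr : ∀ s : List Bool,
      (phi T s false → r (c s + 2) = false) ∧ (phi T s true → r (c s + 2) = true))
    (ρ : ℕ → Bool)
    (hρ : ∀ m : ℕ, ρ m = r (c (List.ofFn fun i : Fin m => ρ i) + 2)) :
    (∀ m n : ℕ, m ≤ n → theta T n (List.ofFn fun i : Fin m => ρ i)) ∧
    (∀ m : ℕ, (List.ofFn fun i : Fin m => ρ i) ∈ T) := by
  have main : ∀ m n : ℕ, m ≤ n → theta T n (List.ofFn fun i : Fin m => ρ i) := by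
    intro m
    induction m with
    | zero =>
      intro n _
      obtain ⟨t, ht, hl⟩ := hinf n
      exact ⟨t, ht, hl, by simp⟩
    | succ m ih =>
      intro n hn
      have e : (List.ofFn fun i : Fin (m + 1) => ρ i)
          = (List.ofFn fun i : Fin m => ρ i) ++ [ρ m] := by
        rw [List.ofFn_succ_last]
        simp
      rw [e]
      have hm := hρ m
      have hlen : (List.ofFn fun i : Fin m => ρ i).length = m := by simp
      have h := ih n (by omega)
      generalize (List.ofFn fun i : Fin m => ρ i) = s at hm h hlen
      by_contra hcon
      obtain ⟨t, ht, hl, u, hu⟩ := h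
      cases u with
      | nil =>
        have := congrArg List.length hu
        simp at this
        omega
      | cons b u =>
        have hb : theta T n (s ++ [b]) := ⟨t, ht, hl, u, by simpa using hu⟩
        have hs := hr s
        rw [← hm] at hs
        generalize ρ m = x at hs hcon
        cases b <;> cases x
        · exact hcon hb
        · exact absurd (hs.1 ⟨n, hb, hcon⟩) (by simp)
        · exact absurd (hs.2 ⟨n, hb, hcon⟩) (by simp)
        · exact hcon hb
  refine ⟨main, fun m => ?_⟩
  obtain ⟨t, ht, _, hp⟩ := main m m le_rfl
  exact htree t ht _ hp
end

section
/- Let X be a complete metric space, K ⊆ X compact, b : ℕ → X, α : ℕ → ℝ with α i ≥ 0 for all i, and let A := X \ ⋃_i {x | dist x (b i) < α i}. Assume A is nonempty and A ⊆ K. Let q : ℕ → ℕ and let x : ℕ → ℕ → X be such that for every n, K ⊆ ⋃_{j < q n} {y | dist y (x n j) < 2^{−n}}. Define T to be the set of all finite sequences s of natural numbers such that: for all n < length s, s n < q n; for all n, i < length s, dist (x n (s n)) (x i (s i)) ≤ 2^{−n} + 2^{−i}; and for all n, i < length s, dist (x n (s n)) (b i) ≥ α i − 2^{−n}. Then T is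 closed under taking prefixes and contains a sequence of every length; moreover, for every f : ℕ → ℕ all of whose finite initial segments belong to T, the sequence (x n (f n))_{n∈ℕ} is Cauchy and its limit belongs to A. -/
/-- the tree of approximations selects a point of a closed subset `A`
of a compact set `K`. -/
theorem stmt_3 {X : Type*} [MetricSpace X] [CompleteSpace X]
    (K : Set X) (hK : IsCompact K)
    (b : ℕ → X) (α : ℕ → ℝ) (hα : ∀ i, 0 ≤ α i)
    (A : Set X) (hA : A = Set.univ \ ⋃ i : ℕ, {x : X | dist x (b i) < α i})
    (hne : A.Nonempty) (hAK : A ⊆ K)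
    (q : ℕ → ℕ) (x : ℕ → ℕ → X)
    (hcov : ∀ n : ℕ, K ⊆ ⋃ j < q n, {y : X | dist y (x n j) < (2:ℝ) ^ (-(n:ℤ))})
    (T : Set (List ℕ))
    (hT : T = {s : List ℕ |
      (∀ (n : ℕ) (hn : n < s.length), s.get ⟨n, hn⟩ < q n) ∧
      (∀ (n i : ℕ) (hn : n < s.length) (hi : i < s.length),
        dist (x n (s.get ⟨n, hn⟩)) (x i (s.get ⟨i, hi⟩)) ≤ (2:ℝ) ^ (-(n:ℤ)) + (2:ℝ) ^ (-(i:ℤ))) ∧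
      (∀ (n i : ℕ) (hn : n < s.length), i < s.length →
        α i - (2:ℝ) ^ (-(n:ℤ)) ≤ dist (x n (s.get ⟨n, hn⟩)) (b i))}) :
    (∀ t ∈ T, ∀ u, u <+: t → u ∈ T) ∧
    (∀ n : ℕ, ∃ t ∈ T, t.length = n) ∧
    (∀ f : ℕ → ℕ, (∀ n : ℕ, (List.ofFn fun i : Fin n => f i) ∈ T) →
      CauchySeq (fun n => x n (f n)) ∧
      ∃ L ∈ A, Filter.Tendsto (fun n => x n (f n)) Filter.atTop (nhds L)) := by
  subst hT
  refine ⟨?_, ?_, ?_⟩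
  · rintro t ⟨h1, h2, h3⟩ u ⟨v, rfl⟩
    have hl : ∀ n, n < u.length → n < (u ++ v).length := by
      intro n hn
      rw [List.length_append]
      omega
    have hg : ∀ n (hn : n < u.length), (u ++ v).get ⟨n, hl n hn⟩ = u.get ⟨n, hn⟩ := by
      intro n hn
      simp [List.getElem_append_left hn]
    refine ⟨?_, ?_, ?_⟩
    · intro n hn
      rw [← hg n hn]
      exact h1 n (hl n hn)
    · intro n i hn hi
      rw [← hg n hn, ← hg i hi]
      exact h2 n i (hl n hn) (hl i hi)
    · intro n i hn hi
      rw [← hg n hn]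
      exact h3 n i (hl n hn) (hl i hi)
  · intro N
    obtain ⟨a, ha⟩ := hne
    have hc : ∀ n, ∃ j, j < q n ∧ dist a (x n j) < (2:ℝ) ^ (-(n:ℤ)) := by
      intro n
      have := hcov n (hAK ha)
      simpa only [Set.mem_iUnion, Set.mem_ofPred_eq, exists_prop] using this
    choose g hg1 hg2 using hc
    have hb : ∀ i, α i ≤ dist a (b i) := by
      intro i
      rw [hA] at ha
      by_contra hlt
      exact ha.2 (Set.mem_iUnion.2 ⟨i, not_le.1 hlt⟩)
    refine ⟨List.ofFn fun i : Fin N => g i, ⟨?_, ?_, ?_⟩, by simp⟩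
    · intro n hn
      simpa using hg1 n
    · intro n i hn hi
      simp only [List.get_eq_getElem, List.getElem_ofFn]
      have := dist_triangle_left (x n (g n)) (x i (g i)) a
      linarith [hg2 n, hg2 i]
    · intro n i hn hi
      simp only [List.get_eq_getElem, List.getElem_ofFn]
      have := dist_triangle a (x n (g n)) (b i)
      linarith [hg2 n, hb i]
  · intro f hf
    have hd : ∀ n i : ℕ, dist (x n (f n)) (x i (f i)) ≤ (2:ℝ) ^ (-(n:ℤ)) + (2:ℝ) ^ (-(i:ℤ)) := by
      intro n i
      have h := (hf (n + i + 1)).2.1 n i (by rw [List.length_ofFn]; omega) (by rw [List.length_ofFn]; omega)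
      simpa only [List.get_eq_getElem, List.getElem_ofFn] using h
    have hb : ∀ n i : ℕ, α i - (2:ℝ) ^ (-(n:ℤ)) ≤ dist (x n (f n)) (b i) := by
      intro n i
      have h := (hf (n + i + 1)).2.2 n i (by rw [List.length_ofFn]; omega) (by rw [List.length_ofFn]; omega)
      simpa only [List.get_eq_getElem, List.getElem_ofFn] using h
    have hlim : Filter.Tendsto (fun n : ℕ => (2:ℝ) ^ (-(n:ℤ))) Filter.atTop (nhds 0) := by
      have := tendsto_pow_atTop_nhds_zero_of_lt_one (r := (1/2 : ℝ)) (by norm_num) (by norm_num)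
      refine this.congr fun n => ?_
      simp
    have hC : CauchySeq (fun n => x n (f n)) := by
      rw [Metric.cauchySeq_iff]
      intro ε hε
      obtain ⟨N, hN⟩ := Filter.eventually_atTop.1 (hlim.eventually (gt_mem_nhds (half_pos hε)))
      refine ⟨N, fun m hm n hn => ?_⟩
      linarith [hd m n, hN m hm, hN n hn]
    refine ⟨hC, ?_⟩
    obtain ⟨L, hL⟩ := cauchySeq_tendsto_of_complete hC
    refine ⟨L, ?_, hL⟩
    rw [hA]
    refine ⟨Set.mem_univ _, ?_⟩
    intro hmem
    obtain ⟨i, hi⟩ := Set.mem_iUnion.1 hmem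
    have h1 : Filter.Tendsto (fun n : ℕ => α i - (2:ℝ) ^ (-(n:ℤ))) Filter.atTop
        (nhds (α i - 0)) := tendsto_const_nhds.sub hlim
    have h2 := le_of_tendsto_of_tendsto' h1 (hL.dist (tendsto_const_nhds (x := b i)))
      (fun n => hb n i)
    have h3 : dist L (b i) < α i := hi
    linarith
end

section
/- There do not exist functions h : (ℕ → ℕ) → (List Bool → Bool) and k : ((ℕ → ℕ) × (ℕ → Bool)) → Bool, both continuous (where ℕ → ℕ, ℕ → Bool and List Bool → Bool carry the product topology with ℕ and Bool discrete), such that for every p : ℕ → ℕ the set T_p := {t : List Bool | h p t = true} is an infinite binary tree, and for every infinite path r of T_p one has k (p, r) = false if p is the constant zero function and k (p, r) = true otherwise. -/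
theorem clopen_aux (n : ℕ) (A : Set (List Bool)) :
    IsClosed {r : ℕ → Bool | (List.ofFn fun i : Fin n => r i) ∈ A} := by
  have hc : Continuous (fun (r : ℕ → Bool) (i : Fin n) => r i) := by fun_prop
  exact (isClosed_discrete {f : Fin n → Bool | List.ofFn f ∈ A}).preimage hc

theorem path_aux (T : Set (List Bool)) (h1 : ∀ t ∈ T, ∀ s, s <+: t → s ∈ T)
    (h2 : ∀ n : ℕ, ∃ t ∈ T, t.length = n) :
    ∃ r : ℕ → Bool, ∀ n : ℕ, (List.ofFn fun i : Fin n => r i) ∈ T := by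
  have := IsCompact.nonempty_iInter_of_sequence_nonempty_isCompact_isClosed
    (fun n : ℕ => {r : ℕ → Bool | (List.ofFn fun i : Fin n => r i) ∈ T})
    (by
      intro n r hr
      refine h1 _ hr _ ?_
      rw [List.ofFn_succ']
      simp)
    (by
      intro n
      obtain ⟨t, ht, rfl⟩ := h2 n
      refine ⟨fun i => t.getD i false, ?_⟩
      have : (List.ofFn fun i : Fin t.length => t.getD i false) = t := by
        apply List.ext_getElem <;> simp
      simpa [this] using ht)
    (clopen_aux 0 T).isCompact (fun n => clopen_aux n T)
  obtain ⟨r, hr⟩ := this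
  exact ⟨r, fun n => Set.mem_iInter.1 hr n⟩

/-- there is no continuous pair `(h, k)` such that `h` maps every `p : ℕ → ℕ`
to (the characteristic function of) an infinite binary tree all of whose infinite paths `r`
make `k (p, r)` decide whether `p` is the constant zero function. -/
theorem stmt_5 :
    ¬ ∃ (h : (ℕ → ℕ) → (List Bool → Bool)) (k : (ℕ → ℕ) × (ℕ → Bool) → Bool),
      Continuous h ∧ Continuous k ∧
      ∀ p : ℕ → ℕ,
        ((∀ t ∈ {t : List Bool | h p t = true}, ∀ s, s <+: t → s ∈ {t : List Bool | h p t = true}) ∧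
          (∀ n : ℕ, ∃ t ∈ {t : List Bool | h p t = true}, t.length = n)) ∧
        (∀ r : ℕ → Bool, (∀ n : ℕ, (List.ofFn fun i : Fin n => r i) ∈ {t : List Bool | h p t = true}) →
          ((∀ n, p n = 0) → k (p, r) = false) ∧ ((¬ ∀ n, p n = 0) → k (p, r) = true)) := by
  rintro ⟨h, k, hh, hk, H⟩
  have hS : IsClosed ({x : (ℕ → ℕ) × (ℕ → Bool) | ∀ (n : ℕ) (t : List Bool),
      (List.ofFn fun i : Fin n => x.2 i) ∈ ({t}ᶜ : Set (List Bool)) ∨ h x.1 t = true} ∩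
      {x | k x = true}) := by
    refine IsClosed.inter ?_ (isClosed_eq hk continuous_const)
    simp only [Set.ofPred_forall]
    refine isClosed_iInter fun n => isClosed_iInter fun t => ?_
    refine IsClosed.union ((clopen_aux n {t}ᶜ).preimage continuous_snd) ?_
    exact isClosed_eq (((continuous_apply t).comp hh).comp continuous_fst) continuous_const
  have hC := isClosedMap_fst_of_compactSpace _ hS
  have key : ∀ p : ℕ → ℕ, (¬ ∀ n, p n = 0) → p ∈ Set.image Prod.fst
      ({x : (ℕ → ℕ) × (ℕ → Bool) | ∀ (n : ℕ) (t : List Bool),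
      (List.ofFn fun i : Fin n => x.2 i) ∈ ({t}ᶜ : Set (List Bool)) ∨ h x.1 t = true} ∩
      {x | k x = true}) := by
    intro p hp
    obtain ⟨r, hr⟩ := path_aux _ (H p).1.1 (H p).1.2
    refine ⟨(p, r), ⟨fun n t => ?_, ((H p).2 r hr).2 hp⟩, rfl⟩
    by_cases e : (List.ofFn fun i : Fin n => r i) = t
    · right
      rw [← e]
      exact hr n
    · left
      exact e
  have lim : Filter.Tendsto (fun n : ℕ => (Pi.single n 1 : ℕ → ℕ)) Filter.atTop (nhds 0) := by
    rw [tendsto_pi_nhds]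
    intro m
    refine tendsto_const_nhds.congr' ?_
    filter_upwards [Filter.eventually_gt_atTop m] with n hn
    simp [hn.ne]
  have h0 := hC.mem_of_tendsto lim (Filter.Eventually.of_forall fun n => key _ (by
    intro hz
    simpa using hz n))
  obtain ⟨⟨p, r⟩, ⟨h1, h2⟩, h3⟩ := h0
  simp only at h3
  subst h3
  have := ((H 0).2 r (fun n => (h1 n _).resolve_left (by simp))).1 (fun _ => rfl)
  simp only [Set.mem_ofPred_eq] at h2
  rw [this] at h2
  exact absurd h2 (by simp)
end

section
/- Let T be an infinite binary tree and let F : List Bool → Set (List Bool) be such that: every F t is a binary tree; F is antitone with respect to the prefix order (if t is a prefix of u then F u ⊆ F t); and for every infinite path p of T, the set ⋂_n F [p 0, …, p (n−1)] is an infinite binary tree. Define T̃ := {t : List Bool | t₀ ∈ T ∧ t₁ ∈ F t₀}, where t₀ and t₁ denote the subsequences of even-indexed and odd-indexed entries of t respectively. Then T̃ is an infinite binary tree, and for every infinite path p of T̃, the function p₀ := (n ↦ p (2n)) is an infinite path of T and the function p₁ := (n ↦ p (2n+1)) is an infinite path of ⋂_n F [p₀ 0, …, p₀ (n−1)]. 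-/
/-- The even-indexed entries of a list. -/
def evens : List Bool → List Bool
  | [] => []
  | [a] => [a]
  | a :: _ :: l => a :: evens l

/-- The odd-indexed entries of a list. -/
def odds : List Bool → List Bool
  | [] => []
  | _ :: l => evens l

theorem ofFn_eq_map (p : ℕ → Bool) (n : ℕ) :
    (List.ofFn fun i : Fin n => p i) = (List.range n).map p := by
  apply List.ext_getElem <;> simp

theorem map_range_prefix (p : ℕ → Bool) {n k : ℕ} (h : n ≤ k) :
    (List.range n).map p <+: (List.range k).map p := by
  apply List.IsPrefix.map
  obtain ⟨d, rfl⟩ := Nat.exists_eq_add_of_le h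
  rw [List.range_add]
  exact List.prefix_append _ _

theorem evens_prefix : ∀ s t : List Bool, s <+: t → evens s <+: evens t
  | [], _, _ => by simp [evens]
  | [a], t, h => by
    obtain ⟨r, rfl⟩ := h
    cases r <;> simp [evens]
  | a :: b :: l, t, h => by
    obtain ⟨r, rfl⟩ := h
    have := evens_prefix l (l ++ r) (List.prefix_append _ _)
    simpa [evens] using this

theorem odds_prefix (s t : List Bool) (h : s <+: t) : odds s <+: odds t := by
  obtain ⟨r, rfl⟩ := h
  cases s with
  | nil => simp [odds]
  | cons a l => exact evens_prefix l (l ++ r) (List.prefix_append _ _)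

theorem map_range_step (p : ℕ → Bool) (n : ℕ) :
    (List.range (2 * (n + 1))).map p
      = p 0 :: p 1 :: (List.range (2 * n)).map (fun i => p (i + 2)) := by
  rw [show 2 * (n + 1) = 2 * n + 1 + 1 by ring, List.range_succ_eq_map, List.range_succ_eq_map]
  simp [Function.comp_def]

theorem evens_map (n : ℕ) : ∀ p : ℕ → Bool,
    evens ((List.range (2 * n)).map p) = (List.range n).map (fun i => p (2 * i)) := by
  induction n with
  | zero => intro p; simp [evens]
  | succ n ih =>
    intro p
    rw [map_range_step, evens, ih, List.range_succ_eq_map]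
    simp [Function.comp_def, mul_add]

theorem odds_cons_cons (a b : Bool) (l : List Bool) : odds (a :: b :: l) = b :: odds l := by
  cases l <;> simp [odds, evens]

theorem odds_map (n : ℕ) : ∀ p : ℕ → Bool,
    odds ((List.range (2 * n)).map p) = (List.range n).map (fun i => p (2 * i + 1)) := by
  induction n with
  | zero => intro p; simp [odds]
  | succ n ih =>
    intro p
    rw [map_range_step, odds_cons_cons, ih, List.range_succ_eq_map]
    simp [Function.comp_def, mul_add, add_right_comm]

/-- Weak Koenig's lemma. -/
theorem wkl (T : Set (List Bool))
    (htree : ∀ t ∈ T, ∀ s, s <+: t → s ∈ T)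
    (hinf : ∀ n : ℕ, ∃ t ∈ T, t.length = n) :
    ∃ p : ℕ → Bool, ∀ n, (List.range n).map p ∈ T := by
  classical
  let E : List Bool → Prop := fun s => ∀ n, ∃ t ∈ T, s <+: t ∧ n ≤ t.length
  have hstep : ∀ s, E s → ∃ b, E (s ++ [b]) := by
    intro s hs
    by_contra hcon
    have h1 : ¬ E (s ++ [true]) := fun h => hcon ⟨_, h⟩
    have h2 : ¬ E (s ++ [false]) := fun h => hcon ⟨_, h⟩
    simp only [E, not_forall] at h1 h2
    obtain ⟨n1, h1⟩ := h1
    obtain ⟨n2, h2⟩ := h2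
    obtain ⟨t, ht, ⟨r, rfl⟩, hl⟩ := hs (n1 + n2 + s.length + 1)
    cases r with
    | nil => simp at hl
    | cons b r =>
      cases b
      · exact h2 ⟨_, ht, ⟨r, by simp⟩, by omega⟩
      · exact h1 ⟨_, ht, ⟨r, by simp⟩, by omega⟩
  have hE0 : E [] := by
    intro n
    obtain ⟨t, ht, hl⟩ := hinf n
    exact ⟨t, ht, List.nil_prefix, hl.ge⟩
  have hstep' : ∀ s, ∃ b, E s → E (s ++ [b]) := by
    intro s
    by_cases h : E s
    · obtain ⟨b, hb⟩ := hstep s h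
      exact ⟨b, fun _ => hb⟩
    · exact ⟨true, fun h' => absurd h' h⟩
  choose f hf using hstep'
  let q : ℕ → List Bool := fun n => Nat.rec [] (fun _ s => s ++ [f s]) n
  have hq : ∀ n, E (q n) := by
    intro n
    induction n with
    | zero => exact hE0
    | succ n ih => exact hf _ ih
  have hm : ∀ n, (List.range n).map (fun i => f (q i)) = q n := by
    intro n
    induction n with
    | zero => rfl
    | succ n ih => rw [List.range_succ, List.map_append, ih]; rfl
  refine ⟨fun i => f (q i), fun n => ?_⟩
  rw [hm]
  obtain ⟨t, ht, hp, _⟩ := hq n 0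
  exact htree t ht _ hp

/-- interleaving a tree `T` with a tree-valued antitone approximation `F`. -/
theorem stmt_6 (T : Set (List Bool))
    (htree : ∀ t ∈ T, ∀ s, s <+: t → s ∈ T)
    (hinf : ∀ n : ℕ, ∃ t ∈ T, t.length = n)
    (F : List Bool → Set (List Bool))
    (hFtree : ∀ t : List Bool, ∀ u ∈ F t, ∀ s, s <+: u → s ∈ F t)
    (hFanti : ∀ t u : List Bool, t <+: u → F u ⊆ F t)
    (hFpath : ∀ p : ℕ → Bool, (∀ n : ℕ, (List.ofFn fun i : Fin n => p i) ∈ T) →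
      (∀ u ∈ ⋂ n : ℕ, F (List.ofFn fun i : Fin n => p i),
        ∀ s, s <+: u → s ∈ ⋂ n : ℕ, F (List.ofFn fun i : Fin n => p i)) ∧
      (∀ m : ℕ, ∃ u ∈ ⋂ n : ℕ, F (List.ofFn fun i : Fin n => p i), u.length = m))
    (Ttil : Set (List Bool))
    (hTtil : Ttil = {t : List Bool | evens t ∈ T ∧ odds t ∈ F (evens t)}) :
    ((∀ t ∈ Ttil, ∀ s, s <+: t → s ∈ Ttil) ∧ (∀ n : ℕ, ∃ t ∈ Ttil, t.length = n)) ∧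
    (∀ p : ℕ → Bool, (∀ n : ℕ, (List.ofFn fun i : Fin n => p i) ∈ Ttil) →
      (∀ n : ℕ, (List.ofFn fun i : Fin n => p (2 * i)) ∈ T) ∧
      (∀ n : ℕ, (List.ofFn fun i : Fin n => p (2 * i + 1)) ∈
        ⋂ m : ℕ, F (List.ofFn fun i : Fin m => p (2 * i)))) := by
  have e0 : ∀ (p : ℕ → Bool) (n : ℕ), (List.ofFn fun i : Fin n => p (2 * i))
      = (List.range n).map (fun i => p (2 * i)) := fun p n => ofFn_eq_map (fun i => p (2 * i)) n
  have e1 : ∀ (p : ℕ → Bool) (n : ℕ), (List.ofFn fun i : Fin n => p (2 * i + 1))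
      = (List.range n).map (fun i => p (2 * i + 1)) :=
    fun p n => ofFn_eq_map (fun i => p (2 * i + 1)) n
  simp only [e0, e1, ofFn_eq_map] at hFpath ⊢
  subst hTtil
  have hclosed : ∀ t ∈ {t : List Bool | evens t ∈ T ∧ odds t ∈ F (evens t)}, ∀ s, s <+: t →
      s ∈ {t : List Bool | evens t ∈ T ∧ odds t ∈ F (evens t)} := by
    rintro t ⟨h1, h2⟩ s hs
    exact ⟨htree _ h1 _ (evens_prefix _ _ hs),
      hFtree _ _ (hFanti _ _ (evens_prefix _ _ hs) h2) _ (odds_prefix _ _ hs)⟩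
  refine ⟨⟨hclosed, fun n => ?_⟩, fun p hp => ⟨fun n => ?_, fun n => ?_⟩⟩
  · obtain ⟨p, hp⟩ := wkl T htree hinf
    obtain ⟨u, hu, hl⟩ := (hFpath p hp).2 n
    rw [Set.mem_iInter] at hu
    let q : ℕ → Bool := fun i => if i % 2 = 0 then p (i / 2) else u.getD (i / 2) false
    have hev : evens ((List.range (2 * n)).map q) = (List.range n).map p := by
      rw [evens_map]
      apply List.map_congr_left
      intro i _
      simp [q]
    have hod : odds ((List.range (2 * n)).map q) = u := by
      rw [odds_map]
      apply List.ext_getElem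
      · simp [hl]
      · intro i h1 h2
        have h3 : (2 * i + 1) % 2 = 1 := by omega
        have h4 : (2 * i + 1) / 2 = i := by omega
        simp [q, h3, h4, h2]
    refine ⟨(List.range n).map q, hclosed ((List.range (2 * n)).map q) ⟨?_, ?_⟩ _
      (map_range_prefix q (by omega)), by simp⟩
    · rw [hev]; exact hp n
    · rw [hev, hod]; exact hu n
  · have := (hp (2 * n)).1
    rwa [evens_map] at this
  · rw [Set.mem_iInter]
    intro m
    have := (hp (2 * max n m)).2
    rw [evens_map, odds_map] at this
    exact hFtree _ _ (hFanti _ _ (map_range_prefix _ (le_max_right n m)) this) _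
      (map_range_prefix (fun i => p (2 * i + 1)) (le_max_left n m))
end

section
/- Let δ ∈ ℝ with 0 < |δ| ≤ 1, and let ν_δ be as defined. If ψ : ℝ² → ℝ is a linear map with |ψ v| ≤ ν_δ(v) for all v ∈ ℝ² and ψ(1, 0) = 1, then ψ(0, 1) = −1 in case δ > 0, and ψ(0, 1) = 1 in case δ < 0. -/
/-- The norm `ν_δ` on `ℝ²`. -/
noncomputable def nu (δ : ℝ) (v : ℝ × ℝ) : ℝ :=
  if 0 < δ then max |(1 - δ) / (1 + δ) * v.1 + v.2| |v.1 - v.2|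
  else if δ < 0 then max |(1 + δ) / (1 - δ) * v.1 - v.2| |v.1 + v.2|
  else max |v.1 + v.2| |v.1 - v.2|

theorem aux_pos (c y : ℝ) (hc0 : 0 ≤ c) (hc1 : c < 1)
    (h : ∀ t : ℝ, |1 + t * y| ≤ max |c + t| |1 - t|) : y = -1 := by
  have key : ∀ t : ℝ, |t| ≤ (1 - c) / 2 → 1 + t * y ≤ 1 - t := by
    intro t ht
    obtain ⟨ha, hb⟩ := abs_le.mp ht
    have h2 : max |c + t| |1 - t| ≤ 1 - t := by
      apply max_le
      · rw [abs_le]; constructor <;> linarith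
      · rw [abs_of_nonneg (by linarith)]
    exact (le_abs_self _).trans ((h t).trans h2)
  have k1 := key ((1 - c) / 2) (by rw [abs_of_nonneg (by linarith)])
  have k2 := key (-((1 - c) / 2)) (by rw [abs_neg, abs_of_nonneg (by linarith)])
  have h3 : (1 - c) / 2 * (y + 1) = 0 := by linarith
  rcases mul_eq_zero.mp h3 with h4 | h4 <;> linarith

/-- a linear functional dominated by `ν_δ` taking value `1` at `(1,0)`
is forced at `(0,1)`. -/
theorem stmt_7 (δ : ℝ) (h0 : 0 < |δ|) (h1 : |δ| ≤ 1)
    (ψ : ℝ × ℝ →ₗ[ℝ] ℝ) (hψ : ∀ v : ℝ × ℝ, |ψ v| ≤ nu δ v)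
    (hone : ψ (1, 0) = 1) :
    (0 < δ → ψ (0, 1) = -1) ∧ (δ < 0 → ψ (0, 1) = 1) := by
  have hval : ∀ t : ℝ, ψ (1, t) = 1 + t * ψ (0, 1) := by
    intro t
    have : ((1, t) : ℝ × ℝ) = (1, 0) + t • (0, 1) := by simp
    rw [this, map_add, map_smul, hone, smul_eq_mul]
  obtain ⟨hl, hu⟩ := abs_le.mp h1
  constructor
  · intro hd
    apply aux_pos ((1 - δ) / (1 + δ))
    · exact div_nonneg (by linarith) (by linarith)
    · rw [div_lt_one (by linarith)]; linarith
    · intro t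
      have := hψ (1, t)
      rw [hval] at this
      simpa [nu, hd] using this
  · intro hd
    have : -ψ (0, 1) = -1 := by
      apply aux_pos ((1 + δ) / (1 - δ))
      · exact div_nonneg (by linarith) (by linarith)
      · rw [div_lt_one (by linarith)]; linarith
      · intro t
        have := hψ (1, -t)
        rw [hval] at this
        simpa [nu, hd, not_lt.mpr hd.le, sub_eq_add_neg] using this
    linarith
end

section
/- For every δ ∈ ℝ with |δ| ≤ 1, the function ν_δ is a norm on ℝ², and moreover ν_δ(α, 0) = |α| and ν_δ(0, β) = |β| for all α, β ∈ ℝ. -/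
/-- Uniform description of `nu`. -/
theorem nu_form (δ : ℝ) (h1 : |δ| ≤ 1) :
    ∃ c s : ℝ, 0 ≤ c ∧ c ≤ 1 ∧ (s = 1 ∨ s = -1) ∧
      ∀ v : ℝ × ℝ, nu δ v = max |c * v.1 + s * v.2| |v.1 - s * v.2| := by
  obtain ⟨ha, hb⟩ := abs_le.mp h1
  rcases lt_trichotomy δ 0 with h | h | h
  · refine ⟨(1 + δ) / (1 - δ), -1, div_nonneg (by linarith) (by linarith),
      (div_le_one (by linarith)).2 (by linarith), Or.inr rfl, fun v => ?_⟩
    have h' : ¬ 0 < δ := by linarith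
    simp only [nu, h, h', if_true, if_false]
    congr 2 <;> ring
  · subst h
    refine ⟨1, 1, by norm_num, le_refl _, Or.inl rfl, fun v => ?_⟩
    simp [nu]
  · refine ⟨(1 - δ) / (1 + δ), 1, div_nonneg (by linarith) (by linarith),
      (div_le_one (by linarith)).2 (by linarith), Or.inl rfl, fun v => ?_⟩
    simp [nu, h]

/-- for `|δ| ≤ 1`, `ν_δ` is a norm on `ℝ²` with `ν_δ(α,0) = |α|` and
`ν_δ(0,β) = |β|`. -/
theorem stmt_8 (δ : ℝ) (h1 : |δ| ≤ 1) :
    (∀ v : ℝ × ℝ, 0 ≤ nu δ v) ∧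
    (∀ v : ℝ × ℝ, nu δ v = 0 ↔ v = 0) ∧
    (∀ (a : ℝ) (v : ℝ × ℝ), nu δ (a • v) = |a| * nu δ v) ∧
    (∀ v w : ℝ × ℝ, nu δ (v + w) ≤ nu δ v + nu δ w) ∧
    (∀ α : ℝ, nu δ (α, 0) = |α|) ∧
    (∀ β : ℝ, nu δ (0, β) = |β|) := by
  obtain ⟨c, s, hc0, hc1, hs, hnu⟩ := nu_form δ h1
  have hs1 : |s| = 1 := by rcases hs with rfl | rfl <;> simp
  have hs0 : s ≠ 0 := by rcases hs with rfl | rfl <;> norm_num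
  simp only [hnu]
  refine ⟨fun v => le_max_of_le_left (abs_nonneg _), fun v => ⟨fun h => ?_, fun h => ?_⟩,
    fun a v => ?_, fun v w => ?_, fun α => ?_, fun β => ?_⟩
  · have e1 : c * v.1 + s * v.2 = 0 :=
      abs_nonpos_iff.1 ((le_max_left _ _).trans h.le)
    have e2 : v.1 - s * v.2 = 0 :=
      abs_nonpos_iff.1 ((le_max_right _ _).trans h.le)
    have e3 : (c + 1) * v.1 = 0 := by linarith
    have e4 : v.1 = 0 := (mul_eq_zero.1 e3).resolve_left (by linarith)
    have e5 : s * v.2 = 0 := by linarith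
    exact Prod.ext e4 ((mul_eq_zero.1 e5).resolve_left hs0)
  · subst h
    simp
  · rw [mul_max_of_nonneg _ _ (abs_nonneg a), ← abs_mul, ← abs_mul]
    simp only [Prod.smul_fst, Prod.smul_snd, smul_eq_mul]
    congr 2 <;> ring
  · simp only [Prod.fst_add, Prod.snd_add]
    apply max_le
    · have e : c * (v.1 + w.1) + s * (v.2 + w.2)
          = (c * v.1 + s * v.2) + (c * w.1 + s * w.2) := by ring
      rw [e]
      exact (abs_add_le _ _).trans (add_le_add (le_max_left _ _) (le_max_left _ _))
    · have e : (v.1 + w.1) - s * (v.2 + w.2)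
          = (v.1 - s * v.2) + (w.1 - s * w.2) := by ring
      rw [e]
      exact (abs_add_le _ _).trans (add_le_add (le_max_right _ _) (le_max_right _ _))
  · simp only [mul_zero, add_zero, sub_zero, abs_mul, abs_of_nonneg hc0]
    exact max_eq_right (mul_le_of_le_one_left (abs_nonneg _) hc1)
  · simp [abs_mul, hs1]
end

section
/- Let X be a real normed space and w_1, …, w_ℓ ∈ X (ℓ ≥ 1). For m ∈ ℕ let S_{m,ℓ} be the set of tuples (β_1, …, β_ℓ) ∈ ℚ^ℓ such that 2^m · β_i is an integer for every i and 1 ≤ β_1² + β_2² + ⋯ + β_ℓ² ≤ 4. Then the family w_1, …, w_ℓ is linearly independent over ℝ if and only if there exists m ≥ 2ℓ such that for every (β_1, …, β_ℓ) ∈ S_{m,ℓ}, ‖β_1 w_1 + ⋯ + β_ℓ w_ℓ‖ > 2^{−m} · (‖w_1‖ + ⋯ + ‖w_ℓ‖). -/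
lemma aux_round (x : ℝ) : ∃ z : ℤ, |(z : ℝ) - x| ≤ 1 ∧ x ^ 2 ≤ (z : ℝ) ^ 2 := by
  rcases le_total 0 x with h | h
  · refine ⟨⌈x⌉, ?_, ?_⟩
    · rw [abs_le]; constructor <;> linarith [Int.le_ceil x, Int.ceil_lt_add_one x]
    · exact pow_le_pow_left₀ h (Int.le_ceil x) 2
  · refine ⟨⌊x⌋, ?_, ?_⟩
    · rw [abs_le]; constructor <;> linarith [Int.floor_le x, Int.lt_floor_add_one x]
    · nlinarith [Int.floor_le x]

lemma aux_approx (m : ℕ) (x : ℝ) : ∃ b : ℚ, (∃ z : ℤ, (2 : ℚ) ^ m * b = (z : ℚ)) ∧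
    |(b : ℝ) - x| ≤ (2 : ℝ) ^ (-(m : ℤ)) ∧ x ^ 2 ≤ (b : ℝ) ^ 2 := by
  obtain ⟨z, h1, h2⟩ := aux_round (2 ^ m * x)
  have hp : (0 : ℝ) < 2 ^ m := by positivity
  have e : x = (2 ^ m * x) / 2 ^ m := by field_simp
  refine ⟨(z : ℚ) / 2 ^ m, ⟨z, by field_simp⟩, ?_, ?_⟩
  · push_cast
    rw [e, ← sub_div, abs_div, abs_of_pos hp, zpow_neg, zpow_natCast, ← one_div]
    gcongr
  · push_cast
    rw [e, div_pow, div_pow]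
    gcongr

/-- Pour-El–Richards criterion for linear independence in a normed space. -/
theorem stmt_11 {X : Type*} [NormedAddCommGroup X] [NormedSpace ℝ X]
    (ℓ : ℕ) (hℓ : 1 ≤ ℓ) (w : Fin ℓ → X) :
    LinearIndependent ℝ w ↔
      ∃ m : ℕ, 2 * ℓ ≤ m ∧
        ∀ β : Fin ℓ → ℚ,
          (∀ i, ∃ z : ℤ, (2 : ℚ) ^ m * β i = (z : ℚ)) →
          (1 : ℚ) ≤ ∑ i, (β i) ^ 2 →
          (∑ i, (β i) ^ 2) ≤ 4 →
          (2 : ℝ) ^ (-(m : ℤ)) * (∑ i, ‖w i‖) < ‖∑ i, ((β i : ℝ)) • w i‖ := by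
  constructor
  · intro h
    have hk : LinearMap.ker (Fintype.linearCombination ℝ w) = ⊥ :=
      LinearMap.ker_eq_bot.mpr (h.fintypeLinearCombination_injective)
    obtain ⟨K, hK, hA⟩ := LinearMap.exists_antilipschitzWith _ hk
    have hb : ∀ v : Fin ℓ → ℝ, ‖v‖ ≤ K * ‖∑ i, v i • w i‖ := by
      intro v
      have := hA.le_mul_dist v 0
      simpa [Fintype.linearCombination_apply] using this
    have hKp : (0 : ℝ) < K := by exact_mod_cast hK
    have hl : (1 : ℝ) ≤ ℓ := by exact_mod_cast hℓ
    set S := ∑ i, ‖w i‖ with hS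
    have hS0 : 0 ≤ S := Finset.sum_nonneg fun i _ => norm_nonneg _
    obtain ⟨n, hn⟩ := pow_unbounded_of_one_lt (S * K * ℓ) (one_lt_two : (1 : ℝ) < 2)
    refine ⟨max n (2 * ℓ), le_max_right _ _, fun β _ h1 _ => ?_⟩
    have hn' : S * K * ℓ < 2 ^ (max n (2 * ℓ)) :=
      hn.trans_le (pow_le_pow_right₀ one_le_two (le_max_left _ _))
    generalize max n (2 * ℓ) = m at hn'
    have h1' : (1 : ℝ) ≤ ∑ i, (β i : ℝ) ^ 2 := by exact_mod_cast h1
    have hv := hb (fun i => (β i : ℝ))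
    set v : Fin ℓ → ℝ := fun i => (β i : ℝ) with hvd
    have h2 : ∑ i, (β i : ℝ) ^ 2 ≤ ℓ * ‖v‖ ^ 2 := by
      calc ∑ i, (β i : ℝ) ^ 2 ≤ ∑ i : Fin ℓ, ‖v‖ ^ 2 := by
            apply Finset.sum_le_sum
            intro i _
            rw [← sq_abs]
            exact pow_le_pow_left₀ (abs_nonneg _) (norm_le_pi_norm v i) 2
        _ = _ := by simp
    have h3 : 1 ≤ ℓ * ‖v‖ := by
      by_contra! hc
      have h0 := norm_nonneg v
      have : ‖v‖ ≤ 1 := by nlinarith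
      nlinarith [mul_nonneg h0 (sub_nonneg.2 this)]
    set N := ‖∑ i, (β i : ℝ) • w i‖ with hN
    rw [zpow_neg, zpow_natCast, inv_mul_lt_iff₀ (by positivity)]
    have h4 : 1 ≤ ℓ * (K * N) := h3.trans (by gcongr)
    have hNp : 0 < N := by
      by_contra! hc
      have : ℓ * (K * N) ≤ 0 := by
        apply mul_nonpos_of_nonneg_of_nonpos (by positivity)
        exact mul_nonpos_of_nonneg_of_nonpos hKp.le hc
      linarith
    calc S ≤ S * (ℓ * (K * N)) := le_mul_of_one_le_right hS0 h4
      _ = S * K * ℓ * N := by ring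
      _ < 2 ^ m * N := by gcongr
  · rintro ⟨m, hm, H⟩
    by_contra hd
    rw [Fintype.linearIndependent_iff] at hd
    push Not at hd
    obtain ⟨g, hg, i0, hi0⟩ := hd
    set s := ∑ i, g i ^ 2 with hs
    have hsp : 0 < s := by
      apply Finset.sum_pos' (fun i _ => sq_nonneg _) ⟨i0, Finset.mem_univ _, by positivity⟩
    have hsq : 0 < √s := Real.sqrt_pos.2 hsp
    choose β hz ha hq using fun i => aux_approx m (g i / √s)
    have hone : ∑ i, (g i / √s) ^ 2 = 1 := by
      simp_rw [div_pow, Real.sq_sqrt hsp.le]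
      rw [← Finset.sum_div, div_self hsp.ne']
    have hzero : ∑ i, (g i / √s) • w i = 0 := by
      simp_rw [div_eq_inv_mul, mul_smul]
      rw [← Finset.smul_sum, hg, smul_zero]
    set ε : ℝ := (2 : ℝ) ^ (-(m : ℤ)) with hε
    have hεp : 0 < ε := by positivity
    have hle : ℓ * ε ^ 2 ≤ 1 := by
      have h1 : (ℓ : ℝ) ≤ 2 ^ m := by
        have : ℓ < 2 ^ m := (show ℓ ≤ m by omega).trans_lt Nat.lt_two_pow_self
        exact_mod_cast this.le
      have h2 : (1 : ℝ) ≤ 2 ^ m := one_le_pow₀ one_le_two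
      rw [hε, zpow_neg, zpow_natCast, inv_pow, ← div_eq_mul_inv, div_le_one (by positivity)]
      nlinarith
    have hlow : (1 : ℝ) ≤ ∑ i, (β i : ℝ) ^ 2 := by
      rw [← hone]; exact Finset.sum_le_sum fun i _ => hq i
    have hup : ∑ i, (β i : ℝ) ^ 2 ≤ 4 := by
      calc ∑ i, (β i : ℝ) ^ 2 ≤ ∑ i, (2 * (g i / √s) ^ 2 + 2 * ε ^ 2) := by
            apply Finset.sum_le_sum
            intro i _
            have : ((β i : ℝ) - g i / √s) ^ 2 ≤ ε ^ 2 := sq_le_sq' (abs_le.1 (ha i)).1 (abs_le.1 (ha i)).2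
            nlinarith [sq_nonneg ((β i : ℝ) - 2 * (g i / √s))]
        _ = 2 + 2 * (ℓ * ε ^ 2) := by
            rw [Finset.sum_add_distrib, ← Finset.mul_sum, hone]
            simp; ring
        _ ≤ 4 := by linarith
    have hlt := H β hz (by exact_mod_cast hlow) (by exact_mod_cast hup)
    apply absurd hlt (not_lt.2 _)
    calc ‖∑ i, (β i : ℝ) • w i‖ = ‖∑ i, ((β i : ℝ) - g i / √s) • w i‖ := by
          simp_rw [sub_smul]; rw [Finset.sum_sub_distrib, hzero, sub_zero]
      _ ≤ ∑ i, ε * ‖w i‖ := by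
          apply norm_sum_le_of_le
          intro i _
          rw [norm_smul]
          exact mul_le_mul_of_nonneg_right (ha i) (norm_nonneg _)
      _ = _ := by rw [Finset.mul_sum]
end

section
/- Let p : ℕ → ℕ be injective. For m ∈ ℕ set x_m := Σ_{k=0}^{m} 2^{−(p k + 1)}, and let x := ⨆_m x_m. Then x ≤ 1, and for every n ∈ ℕ and every K ∈ ℕ with x − x_K < 2^{−(n+1)}, one has: there exists m with p m = n if and only if there exists m ≤ K with p m = n. -/
/-- computing membership in the range of an injective `p` from the
supremum of the partial sums `x_m = ∑_{k ≤ m} 2^{-(p k + 1)}`. -/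
theorem stmt_13 (p : ℕ → ℕ) (hp : Function.Injective p)
    (x : ℝ)
    (hx : x = ⨆ m : ℕ, ∑ k ∈ Finset.range (m + 1), (2 : ℝ) ^ (-(p k + 1 : ℤ))) :
    x ≤ 1 ∧
    ∀ n K : ℕ,
      x - (∑ k ∈ Finset.range (K + 1), (2 : ℝ) ^ (-(p k + 1 : ℤ))) < (2 : ℝ) ^ (-(n + 1 : ℤ)) →
      ((∃ m, p m = n) ↔ ∃ m ≤ K, p m = n) := by
  have hs : HasSum (fun j : ℕ => (2 : ℝ) ^ (-(j + 1 : ℤ))) 1 := by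
    convert hasSum_geometric_two' (1 : ℝ) using 2 with j
    rw [zpow_neg, zpow_add₀ (by norm_num), zpow_natCast, zpow_one]
    field_simp
  have hpos : ∀ j : ℕ, (0 : ℝ) < (2 : ℝ) ^ (-(j + 1 : ℤ)) := fun j => by positivity
  have hb : ∀ m : ℕ, ∑ k ∈ Finset.range (m + 1), (2 : ℝ) ^ (-(p k + 1 : ℤ)) ≤ 1 := by
    intro m
    have h := sum_le_hasSum ((Finset.range (m + 1)).image p) (fun j _ => (hpos j).le) hs
    rwa [Finset.sum_image (fun a _ b _ hab => hp hab)] at h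
  refine ⟨hx ▸ ciSup_le hb, fun n K h => ⟨?_, fun ⟨m, _, hm⟩ => ⟨m, hm⟩⟩⟩
  rintro ⟨m, rfl⟩
  refine ⟨m, ?_, rfl⟩
  by_contra hK
  push Not at hK
  have h1 : ∑ k ∈ Finset.range (m + 1), (2 : ℝ) ^ (-(p k + 1 : ℤ)) ≤ x := by
    rw [hx]
    exact le_ciSup (f := fun m : ℕ => ∑ k ∈ Finset.range (m + 1), (2 : ℝ) ^ (-(p k + 1 : ℤ)))
      ⟨1, by rintro _ ⟨i, rfl⟩; exact hb i⟩ m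
  rw [Finset.sum_range_succ] at h1
  have h2 : ∑ k ∈ Finset.range (K + 1), (2 : ℝ) ^ (-(p k + 1 : ℤ))
      ≤ ∑ k ∈ Finset.range m, (2 : ℝ) ^ (-(p k + 1 : ℤ)) :=
    Finset.sum_le_sum_of_subset_of_nonneg (Finset.range_mono hK) (fun i _ _ => (hpos (p i)).le)
  linarith
end

section
/- Let X be a real Banach space, A a closed linear subspace of X, and f : A → ℝ a continuous linear functional with operator norm ‖f‖ ≤ 1. Let D be a dense ℚ-linear subspace of X (a ℚ-submodule whose closure is X), let A₀ be a dense subset of A, and let g₀ : D → ℝ be a ℚ-linear map such that |g₀ d| ≤ ‖d‖ for all d ∈ D, and |f y − g₀ d| ≤ ‖y − d‖ for all y ∈ A₀ and d ∈ D. Then there exists a unique continuous real-linear functional g : X → ℝ with g d = g₀ d for all d ∈ D; moreover ‖g‖ ≤ 1 and g y = f y for all y ∈ A. -/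
/-- extension of a `ℚ`-linear functional defined on a dense `ℚ`-submodule,
compatible with a norm-one functional on a closed subspace. -/
theorem stmt_14 {X : Type*} [NormedAddCommGroup X] [NormedSpace ℝ X] [CompleteSpace X]
    (A : Submodule ℝ X) (hA : IsClosed (A : Set X))
    (f : A →L[ℝ] ℝ) (hf : ‖f‖ ≤ 1)
    (D : Set X) (hD0 : (0 : X) ∈ D)
    (hDadd : ∀ x ∈ D, ∀ y ∈ D, x + y ∈ D)
    (hDsmul : ∀ (c : ℚ), ∀ x ∈ D, (c : ℝ) • x ∈ D)
    (hDdense : Dense D)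
    (A₀ : Set X) (hA₀A : A₀ ⊆ (A : Set X)) (hA₀dense : (A : Set X) ⊆ closure A₀)
    (g₀ : X → ℝ)
    (hadd : ∀ x ∈ D, ∀ y ∈ D, g₀ (x + y) = g₀ x + g₀ y)
    (hsmul : ∀ (c : ℚ), ∀ x ∈ D, g₀ ((c : ℝ) • x) = c * g₀ x)
    (hbound : ∀ d ∈ D, |g₀ d| ≤ ‖d‖)
    (happrox : ∀ y : A, (y : X) ∈ A₀ → ∀ d ∈ D, |f y - g₀ d| ≤ ‖(y : X) - d‖) :
    ∃ g : X →L[ℝ] ℝ,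
      (∀ d ∈ D, g d = g₀ d) ∧
      (∀ g' : X →L[ℝ] ℝ, (∀ d ∈ D, g' d = g₀ d) → g' = g) ∧
      ‖g‖ ≤ 1 ∧
      (∀ y : A, g (y : X) = f y) := by
  have hsub : ∀ x ∈ D, ∀ y ∈ D, x - y ∈ D ∧ g₀ (x - y) = g₀ x - g₀ y := by
    intro x hx y hy
    have e : x - y = x + ((-1 : ℚ) : ℝ) • y := by
      push_cast
      rw [neg_one_smul, sub_eq_add_neg]
    have h1 := hDsmul (-1) y hy
    rw [e]
    refine ⟨hDadd x hx _ h1, ?_⟩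
    rw [hadd x hx _ h1, hsmul (-1) y hy]
    push_cast
    ring
  have hL : LipschitzOnWith 1 g₀ D := by
    refine LipschitzOnWith.of_dist_le_mul ?_
    intro x hx y hy
    obtain ⟨h1, h2⟩ := hsub x hx y hy
    rw [Real.dist_eq, dist_eq_norm, ← h2]
    simpa using hbound _ h1
  obtain ⟨G, hG, hGD⟩ := hL.extend_real
  have hGc : Continuous G := hG.continuous
  have hGadd : ∀ x y, G (x + y) = G x + G y := by
    have h : (fun p : X × X => G (p.1 + p.2)) = fun p => G p.1 + G p.2 := by
      refine Continuous.ext_on (hDdense.prod hDdense) (by fun_prop) (by fun_prop) ?_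
      rintro ⟨x, y⟩ ⟨hx, hy⟩
      simp only at hx hy ⊢
      rw [← hGD hx, ← hGD hy, ← hGD (hDadd x hx y hy), hadd x hx y hy]
    intro x y
    exact congrFun h (x, y)
  let g : X →L[ℝ] ℝ := (AddMonoidHom.mk' G hGadd).toRealLinearMap hGc
  have hg : ∀ x, g x = G x := fun x => rfl
  have hgA₀ : ∀ y : A, (y : X) ∈ A₀ → g (y : X) = f y := by
    intro y hy
    have h : ∀ x : X, |f y - g x| ≤ ‖(y : X) - x‖ := by
      intro x
      have hc : IsClosed {x : X | |f y - g x| ≤ ‖(y : X) - x‖} :=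
        isClosed_le (by fun_prop) (by fun_prop)
      refine hc.closure_subset_iff.2 ?_ (hDdense x)
      intro d hd
      simp only [Set.mem_setOf_eq]
      rw [hg, ← hGD hd]
      exact happrox y hy d hd
    have h1 := h y
    rw [sub_self, norm_zero] at h1
    have h2 := abs_nonpos_iff.1 h1
    linarith
  refine ⟨g, fun d hd => (hGD hd).symm, ?_, ?_, ?_⟩
  · intro g' hg'
    apply DFunLike.coe_injective
    refine Continuous.ext_on hDdense g'.continuous g.continuous ?_
    intro d hd
    rw [hg' d hd, hg, hGD hd]
  · refine g.opNorm_le_bound zero_le_one ?_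
    intro x
    have h := hG.dist_le_mul x 0
    have h0 : G 0 = 0 := by simpa [hg] using g.map_zero
    rw [h0] at h
    simpa [hg] using h
  · have hd : Dense {y : A | (y : X) ∈ A₀} := by
      intro y
      rw [closure_subtype]
      have e : ((↑) '' {y : A | (y : X) ∈ A₀} : Set X) = A₀ := by
        ext x
        constructor
        · rintro ⟨z, hz, rfl⟩
          exact hz
        · intro hx
          exact ⟨⟨x, hA₀A hx⟩, hx, rfl⟩
      rw [e]
      exact hA₀dense y.2
    have h : (fun y : A => g (y : X)) = fun y => f y :=
      Continuous.ext_on hd (by fun_prop) (by fun_prop) (fun y hy => hgA₀ y hy)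
    exact fun y => congrFun h y
end
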